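/- Fix a real number ε with 0 < ε < 1/8 and a finite alphabet A with at least two letters. Under the uniform distribution on deterministic complete n-state automata over A, the probability that the automaton is not synchronizing is O(n^{−1/8+ε}) as n → ∞; in particular, a uniform random complete automaton is synchronizing with high probability. -/

import Mathlib

open Classical

/-- The action of a word on the states of a deterministic complete automaton:
`act δ w q` is the state reached from `q` after reading the word `w`
(first letter applied first, so that `δ_{wa} = δ_a ∘ δ_w`). -/
def act {n : ℕ} {A : Type*} (δ : Fin n → A → Fin n) : List A → Fin n → Fin n
  | [], q => q
  | c :: w, q => act δ w (δ q c)

/-- A word `w` is synchronizing for `δ` if the induced action is a constant map. -/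
def IsSyncWord {n : ℕ} {A : Type*} (δ : Fin n → A → Fin n) (w : List A) : Prop :=
  ∃ r : Fin n, ∀ q : Fin n, act δ w q = r

/-- An automaton is synchronizing if it admits a synchronizing word. -/
def IsSynchronizing {n : ℕ} {A : Type*} (δ : Fin n → A → Fin n) : Prop :=
  ∃ w : List A, IsSyncWord δ w

namespace RandomAutomaton

open Finset BigOperators

set_option linter.unusedSectionVars false

section Probability

variable {α β ι κ X Y : Type*}

/-- The probability of the event `p` under the uniform distribution on a finite type. -/
noncomputable def pr [Fintype α] (p : α → Prop) : ℝ := 𝔼 x, if p x then 1 else 0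

theorem pr_eq_card_div [Fintype α] (p : α → Prop) :
    pr p = (#{x | p x} : ℝ) / Fintype.card α := by
  simp [pr, Fintype.expect_eq_sum_div_card]

theorem pr_nonneg [Fintype α] (p : α → Prop) : 0 ≤ pr p :=
  expect_nonneg fun x _ => by positivity

theorem pr_mono [Fintype α] {p q : α → Prop} (h : ∀ x, p x → q x) : pr p ≤ pr q := by
  refine expect_le_expect fun x _ => ?_
  by_cases hp : p x
  · simp [hp, h x hp]
  · simp only [hp, if_false]; positivity

theorem pr_eq_zero [Fintype α] {p : α → Prop} (h : ∀ x, ¬ p x) : pr p = 0 := by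
  simp [pr, h]

theorem pr_or_le [Fintype α] (p q : α → Prop) : pr (fun x => p x ∨ q x) ≤ pr p + pr q := by
  rw [pr, pr, pr, ← expect_add_distrib]
  refine expect_le_expect fun x _ => ?_
  by_cases hp : p x <;> by_cases hq : q x <;> simp [hp, hq]

theorem pr_not [Fintype α] [Nonempty α] (p : α → Prop) : pr (fun x => ¬ p x) = 1 - pr p := by
  have : pr (fun x => ¬ p x) + pr p = 1 := by
    rw [pr, pr, ← expect_add_distrib, ← Fintype.expect_const (ι := α) (1 : ℝ)]
    refine expect_congr rfl fun x _ => ?_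
    by_cases hp : p x <;> simp [hp]
  linarith

theorem pr_exists_le [Fintype α] (s : Finset ι) (p : ι → α → Prop) :
    pr (fun x => ∃ i ∈ s, p i x) ≤ ∑ i ∈ s, pr (p i) := by
  simp only [pr]
  rw [← expect_sum_comm]
  refine expect_le_expect fun x _ => ?_
  by_cases h : ∃ i ∈ s, p i x
  · obtain ⟨i, hi, hp⟩ := h
    rw [if_pos ⟨i, hi, hp⟩]
    calc (1 : ℝ) = if p i x then 1 else 0 := by simp [hp]
      _ ≤ _ := single_le_sum (f := fun i => if p i x then (1 : ℝ) else 0)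
        (fun j _ => by positivity) hi
  · rw [if_neg h]; exact sum_nonneg fun j _ => by positivity

theorem pr_equiv [Fintype α] [Fintype β] (e : α ≃ β) (p : β → Prop) :
    pr (fun x => p (e x)) = pr p :=
  Fintype.expect_equiv e _ _ fun _ => rfl

theorem pr_prod [Fintype α] [Fintype β] (p : α × β → Prop) :
    pr p = 𝔼 a, pr (fun b => p (a, b)) := by
  simp only [pr]
  rw [← univ_product_univ, expect_product]

theorem pr_prod_le [Fintype α] [Fintype β] (p : α → β → Prop) (g : α → ℝ)
    (h : ∀ a, pr (p a) ≤ g a) : pr (fun w : α × β => p w.1 w.2) ≤ 𝔼 a, g a := by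
  rw [pr_prod]
  exact expect_le_expect fun a _ => h a

theorem pr_prod_le_const [Fintype α] [Nonempty α] [Fintype β] (p : α → β → Prop) (c : ℝ)
    (h : ∀ a, pr (p a) ≤ c) : pr (fun w : α × β => p w.1 w.2) ≤ c :=
  (pr_prod_le p _ h).trans_eq (Fintype.expect_const c)

theorem pr_fst [Fintype α] [Fintype β] [Nonempty β] (p : α → Prop) :
    pr (fun w : α × β => p w.1) = pr p := by
  rw [pr_prod]
  exact expect_congr rfl fun a _ => by
    simp only [pr]
    exact Fintype.expect_const (ι := β) (if p a then (1 : ℝ) else 0)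

theorem pr_and_prod [Fintype α] [Fintype β] (p : α → Prop) (q : β → Prop) :
    pr (fun w : α × β => p w.1 ∧ q w.2) = pr p * pr q := by
  rw [pr_prod, pr, expect_mul]
  refine expect_congr rfl fun a _ => ?_
  by_cases hp : p a <;> simp [hp, pr]

theorem pr_gt_le_expect_div [Fintype α] (f : α → ℝ) (hf : ∀ x, 0 ≤ f x) {t : ℝ} (ht : 0 < t) :
    pr (fun x => t < f x) ≤ (𝔼 x, f x) / t := by
  rw [expect_div]
  refine expect_le_expect fun x _ => ?_
  split_ifs with h
  · rw [le_div_iff₀ ht]; linarith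
  · exact div_nonneg (hf x) ht.le

theorem pr_comp_injective [Fintype ι] [DecidableEq ι] [Fintype κ] [DecidableEq κ] [Fintype Y]
    [Nonempty Y]
    {e : ι → κ} (he : Function.Injective e) (p : (ι → Y) → Prop) :
    pr (fun g : κ → Y => p (g ∘ e)) = pr p := by
  let E : ι ⊕ ((Set.range e)ᶜ : Set κ) ≃ κ :=
    ((Equiv.ofInjective e he).sumCongr (Equiv.refl _)).trans (Equiv.Set.sumCompl (Set.range e))
  have hE : ∀ i, E (Sum.inl i) = e i := fun i => by simp [E]
  let F : (κ → Y) ≃ (ι → Y) × (((Set.range e)ᶜ : Set κ) → Y) :=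
    (Equiv.arrowCongr E.symm (Equiv.refl Y)).trans (Equiv.sumArrowEquivProdArrow _ _ _)
  have hF : ∀ g, (F g).1 = g ∘ e := fun g => by
    funext i
    simp [F, hE]
  rw [← pr_fst (β := ((Set.range e)ᶜ : Set κ) → Y) p, ← pr_equiv F]
  simp only [hF]

theorem pr_forall [Fintype ι] [DecidableEq ι] [Fintype Y] (p : ι → Y → Prop) :
    pr (fun g : ι → Y => ∀ i, p i (g i)) = ∏ i, pr (p i) := by
  simp only [pr_eq_card_div]
  rw [prod_div_distrib, ← Nat.cast_prod, ← Fintype.card_piFinset, prod_const, card_univ,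
    Fintype.card_fun, Nat.cast_pow]
  congr 3
  ext g
  simp

theorem pr_eq_const [Fintype ι] [DecidableEq ι] [Fintype Y] (v : ι → Y) :
    pr (fun g : ι → Y => ∀ i, g i = v i) = ((Fintype.card Y : ℝ) ^ Fintype.card ι)⁻¹ := by
  rw [pr_forall (fun i y => y = v i)]
  have : ∀ i, pr (fun y => y = v i) = (Fintype.card Y : ℝ)⁻¹ := fun i => by
    rw [pr_eq_card_div]
    have : ({x | x = v i} : Finset Y) = {v i} := by ext; simp
    rw [this]; simp
  simp [this]

/-- The probability that a uniform random function takes prescribed values at distinct points. -/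
theorem pr_eq_const_of_injective [Fintype ι] [DecidableEq ι] [Fintype κ] [DecidableEq κ] [Fintype Y]
    [Nonempty Y]
    {e : ι → κ} (he : Function.Injective e) (v : ι → Y) :
    pr (fun g : κ → Y => ∀ i, g (e i) = v i) = ((Fintype.card Y : ℝ) ^ Fintype.card ι)⁻¹ :=
  (pr_comp_injective he fun h : ι → Y => ∀ i, h i = v i).trans (pr_eq_const v)

theorem pr_eval [Fintype κ] [DecidableEq κ] [Fintype Y] [Nonempty Y] (k : κ) (p : Y → Prop) :
    pr (fun g : κ → Y => p (g k)) = pr p := by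
  have h := pr_comp_injective (Y := Y) (e := fun _ : Unit => k)
    (fun _ _ _ => rfl) (fun h => p (h ()))
  rw [← pr_equiv (Equiv.funUnique Unit Y) p]
  exact h

theorem pr_eval_pair [Fintype κ] [DecidableEq κ] [Fintype Y] [Nonempty Y] {k l : κ} (hkl : k ≠ l)
    (p : Y → Y → Prop) :
    pr (fun g : κ → Y => p (g k) (g l)) = pr (fun w : Y × Y => p w.1 w.2) := by
  have h := pr_comp_injective (Y := Y) (e := fun i : Bool => if i then l else k)
    (fun i j h => by cases i <;> cases j <;> simp_all [eq_comm]) (fun h => p (h false) (h true))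
  rw [← pr_equiv (Equiv.boolArrowEquivProd Y) fun w : Y × Y => p w.1 w.2]
  simpa using! h

/-- Evaluations of a uniform random function at disjoint pairs of points are independent. -/
theorem pr_forall_pairs [Fintype ι] [DecidableEq ι] [Fintype κ] [DecidableEq κ] [Fintype Y]
    [Nonempty Y]
    {u v : ι → κ} (hu : Function.Injective u) (hv : Function.Injective v) (huv : ∀ i j, u i ≠ v j)
    (p : Y → Y → Prop) :
    pr (fun g : κ → Y => ∀ i, p (g (u i)) (g (v i))) =
      pr (fun w : Y × Y => p w.1 w.2) ^ Fintype.card ι := by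
  have h1 := pr_comp_injective (Y := Y) (e := Sum.elim u v)
    (hu.sumElim hv huv) (fun h => ∀ i, p (h (Sum.inl i)) (h (Sum.inr i)))
  have h2 := pr_equiv ((Equiv.sumArrowEquivProdArrow ι ι Y).trans
    (Equiv.arrowProdEquivProdArrow ι (fun _ => Y) (fun _ => Y)).symm)
    (fun h : ι → Y × Y => ∀ i, p (h i).1 (h i).2)
  have h3 := pr_forall (ι := ι) (fun (_ : ι) (w : Y × Y) => p w.1 w.2)
  rw [prod_const, card_univ] at h3
  rw [← h3, ← h2]
  exact h1

/-- A uniform random function can be resampled independently outside of a fixed set. -/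
theorem pr_piecewise [Fintype κ] [DecidableEq κ] [Fintype Y] [Nonempty Y]
    (s : Finset κ) (p : (κ → Y) → Prop) :
    pr p = pr (fun w : (κ → Y) × (κ → Y) => p (s.piecewise w.1 w.2)) := by
  have h := pr_comp_injective (Y := Y)
    (e := fun x : κ => if x ∈ s then (Sum.inl x : κ ⊕ κ) else Sum.inr x)
    (fun x y h => by dsimp only at h; split_ifs at h <;> simp_all) p
  rw [← h, ← pr_equiv (Equiv.sumArrowEquivProdArrow κ κ Y)]
  congr 1
  funext g
  congr 1
  funext x
  by_cases hx : x ∈ s <;> simp [hx]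

theorem expect_sum_ite [Fintype α] (s : Finset ι) (p : ι → α → Prop) :
    𝔼 x, (#{i ∈ s | p i x} : ℝ) = ∑ i ∈ s, pr (p i) := by
  simp only [pr]
  rw [← expect_sum_comm]
  refine expect_congr rfl fun x _ => ?_
  simp

end Probability

section Trajectories

open Function

variable {X : Type*} [Fintype X] [DecidableEq X]

/-- The cyclic points of a self-map of a finite type. -/
noncomputable def cyc (a : X → X) : Finset X := {x | x ∈ periodicPts a}

/-- The idempotent power of a self-map of a finite type: a retraction onto its cyclic points. -/
def proj (a : X → X) : X → X := a^[(Fintype.card X).factorial]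

/-- The trajectory of `x` consists of a tail of `j` points followed by a cycle of `p` points. -/
def IsRho (a : X → X) (x : X) (j p : ℕ) : Prop :=
  (∀ s t, s < j + p → t < j + p → a^[s] x = a^[t] x → s = t) ∧ a^[j + p] x = a^[j] x

/-- The first `L + 1` points of the trajectory of `x` are distinct. -/
def IsLong (a : X → X) (x : X) (L : ℕ) : Prop :=
  ∀ s t, s ≤ L → t ≤ L → a^[s] x = a^[t] x → s = t

theorem mem_cyc {a : X → X} {x : X} : x ∈ cyc a ↔ x ∈ periodicPts a := by simp [cyc]

theorem iterate_mem_cyc {a : X → X} {x : X} (hx : x ∈ cyc a) (t : ℕ) : a^[t] x ∈ cyc a := by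
  rw [mem_cyc] at *
  exact minimalPeriod_pos_iff_mem_periodicPts.1
    (by rw [minimalPeriod_apply_iterate hx]; exact minimalPeriod_pos_of_mem_periodicPts hx)

theorem mem_cyc_of_iterate_eq {a : X → X} {x : X} {s t : ℕ} (hst : s < t)
    (h : a^[s] x = a^[t] x) : a^[s] x ∈ cyc a := by
  rw [mem_cyc]
  refine mk_mem_periodicPts (n := t - s) (by omega) ?_
  rw [IsPeriodicPt, IsFixedPt, ← iterate_add_apply, Nat.sub_add_cancel hst.le, h]

theorem IsRho.isLong {a : X → X} {x : X} {j p L : ℕ} (h : IsRho a x j p) (hL : L < j + p) :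
    IsLong a x L :=
  fun s t hs ht => h.1 s t (by omega) (by omega)

theorem IsRho.add_le_card {a : X → X} {x : X} {j p : ℕ} (h : IsRho a x j p) :
    j + p ≤ Fintype.card X := by
  have := Fintype.card_le_of_injective (fun s : Fin (j + p) => a^[(s : ℕ)] x)
    fun s t hst => Fin.ext (h.1 s t s.2 t.2 hst)
  simpa using this

theorem exists_iterate_mem_cyc (a : X → X) (x : X) : ∃ t, a^[t] x ∈ cyc a := by
  obtain ⟨s, t, hst, h⟩ := Finite.exists_ne_map_eq_of_infinite (fun t : ℕ => a^[t] x)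
  rcases lt_or_gt_of_ne hst with hlt | hlt
  · exact ⟨s, mem_cyc_of_iterate_eq hlt h⟩
  · exact ⟨t, mem_cyc_of_iterate_eq hlt h.symm⟩

theorem exists_isRho (a : X → X) (x : X) : ∃ j p, 0 < p ∧ IsRho a x j p ∧
    (∀ t, a^[t] x ∈ cyc a ↔ j ≤ t) ∧ minimalPeriod a (proj a x) = p ∧ proj a x ∈ cyc a := by
  have hex := exists_iterate_mem_cyc a x
  obtain ⟨j, hj, hmin⟩ : ∃ j, a^[j] x ∈ cyc a ∧ ∀ t < j, a^[t] x ∉ cyc a :=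
    ⟨Nat.find hex, Nat.find_spec hex, fun t ht => Nat.find_min hex ht⟩
  set p := minimalPeriod a (a^[j] x) with hp
  have hjp := mem_cyc.1 hj
  have hcyc : ∀ t, j ≤ t → a^[t] x = a^[t - j] (a^[j] x) := fun t ht => by
    rw [← iterate_add_apply, Nat.sub_add_cancel ht]
  have hrho : IsRho a x j p := by
    constructor
    · have key : ∀ s t, s < t → t < j + p → a^[s] x ≠ a^[t] x := by
        intro s t hst ht h
        have hs : j ≤ s := not_lt.1 fun hs => hmin s hs (mem_cyc_of_iterate_eq hst h)
        rw [hcyc s hs, hcyc t (by omega)] at h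
        have := (iterate_eq_iterate_iff_of_lt_minimalPeriod (f := a) (x := a^[j] x)
          (m := s - j) (n := t - j) (by omega) (by omega)).1 h
        omega
      intro s t hs ht h
      rcases lt_trichotomy s t with hlt | heq | hlt
      · exact absurd h (key s t hlt ht)
      · exact heq
      · exact absurd h.symm (key t s hlt hs)
    · rw [add_comm, iterate_add_apply, hp, iterate_minimalPeriod]
  have hN : j ≤ (Fintype.card X).factorial :=
    (by have := hrho.add_le_card; omega : j ≤ Fintype.card X).trans (Nat.self_le_factorial _)
  refine ⟨j, p, minimalPeriod_pos_of_mem_periodicPts hjp, hrho, fun t => ⟨fun h => ?_, fun h => ?_⟩,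
    ?_, ?_⟩
  · exact not_lt.1 fun ht => hmin t ht h
  · rw [hcyc t h]; exact iterate_mem_cyc hj _
  · rw [proj, hcyc _ hN, minimalPeriod_apply_iterate hjp]
  · rw [proj, hcyc _ hN]; exact iterate_mem_cyc hj _

theorem proj_mem_cyc (a : X → X) (x : X) : proj a x ∈ cyc a := by
  obtain ⟨j, p, -, -, -, -, h⟩ := exists_isRho a x
  exact h

theorem proj_eq_self {a : X → X} {x : X} (hx : x ∈ cyc a) : proj a x = x := by
  obtain ⟨j, p, hp, h1, h2, h3, -⟩ := exists_isRho a x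
  have hj : j = 0 := by simpa using (h2 0).1 hx
  subst hj
  have hper : IsPeriodicPt a p x := by simpa [IsPeriodicPt, IsFixedPt] using h1.2
  have hle := h1.add_le_card
  exact hper.trans_dvd (Nat.dvd_factorial hp (by omega))

theorem injOn_cyc {a : X → X} : Set.InjOn a (cyc a) := by
  have := (bijOn_periodicPts a).injOn
  simpa [cyc] using this

theorem iterate_injOn_cyc {a : X → X} (t : ℕ) : Set.InjOn a^[t] (cyc a) :=
  (injOn_cyc (a := a)).iterate (fun _ hx => iterate_mem_cyc (a := a) hx 1) t

variable [Nonempty X]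

theorem pr_pattern_le {V D β : Type*} [Fintype V] [DecidableEq V] [Fintype D] [DecidableEq D]
    [Fintype β] {src : D → V} (hsrc : Injective src) (tgt : D → V) (S : (V → X) → β → Prop) (q : ℝ)
    (hS : ∀ v, pr (S v) ≤ q) :
    pr (fun w : (X → X) × β => ∃ v : V → X, Injective v ∧ S v w.2 ∧
      ∀ d, w.1 (v (src d)) = v (tgt d)) ≤
      Fintype.card (V ↪ X) * (((Fintype.card X : ℝ) ^ Fintype.card D)⁻¹ * q) := by
  calc _ ≤ pr (fun w : (X → X) × β => ∃ v ∈ (univ : Finset (V ↪ X)),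
        (∀ d, w.1 (v (src d)) = v (tgt d)) ∧ S v w.2) :=
        pr_mono fun w ⟨v, hv, h1, h2⟩ => ⟨⟨v, hv⟩, mem_univ _, h2, h1⟩
    _ ≤ ∑ v : V ↪ X, pr (fun w : (X → X) × β =>
        (∀ d, w.1 (v (src d)) = v (tgt d)) ∧ S v w.2) := pr_exists_le _ _
    _ ≤ ∑ _v : V ↪ X, ((Fintype.card X : ℝ) ^ Fintype.card D)⁻¹ * q := by
        refine sum_le_sum fun v _ => ?_
        rw [pr_and_prod (fun a : X → X => ∀ d, a (v (src d)) = v (tgt d)) (S v),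
          pr_eq_const_of_injective (e := fun d => v (src d)) (v.injective.comp hsrc)]
        exact mul_le_mul_of_nonneg_left (hS v) (by positivity)
    _ = _ := by rw [sum_const, card_univ, nsmul_eq_mul]

theorem pr_eq_point (c : X) : pr (fun x => x = c) = (Fintype.card X : ℝ)⁻¹ := by
  rw [pr_eq_card_div, card_eq_one.2 ⟨c, by ext; simp⟩]
  simp

theorem pr_eq_point_pair (c d : X) :
    pr (fun w : X × X => w.1 = c ∧ w.2 = d) = (Fintype.card X : ℝ)⁻¹ * (Fintype.card X : ℝ)⁻¹ := by
  rw [pr_and_prod (fun x => x = c) (fun x => x = d), pr_eq_point, pr_eq_point]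

theorem card_embedding_le_pow (V : Type*) [Fintype V] [DecidableEq V] :
    (Fintype.card (V ↪ X) : ℝ) ≤ (Fintype.card X : ℝ) ^ Fintype.card V := by
  rw [Fintype.card_embedding_eq]
  exact_mod_cast Nat.descFactorial_le_pow _ _

theorem card_pos_real : (0 : ℝ) < Fintype.card X := by exact_mod_cast Fintype.card_pos

theorem pr_isRho_le {j p : ℕ} (hp : 0 < p) :
    pr (fun w : (X → X) × X => IsRho w.1 w.2 j p) ≤ 1 / Fintype.card X := by
  have hn := card_pos_real (X := X)
  have hjp : 0 < j + p := by omega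
  obtain ⟨k, hk⟩ : ∃ k, k = j + p := ⟨_, rfl⟩
  let tgt : Fin k → Fin k := fun d => if h : (d : ℕ) + 1 < k then ⟨d + 1, h⟩ else ⟨j, by omega⟩
  let S : (Fin k → X) → X → Prop := fun v x => x = v ⟨0, by omega⟩
  have hS : ∀ v, pr (S v) ≤ (Fintype.card X : ℝ)⁻¹ := fun v => (pr_eq_point _).le
  calc _ ≤ pr (fun w : (X → X) × X => ∃ v : Fin k → X, Injective v ∧ S v w.2 ∧
          ∀ d, w.1 (v (id d)) = v (tgt d)) := by
        refine pr_mono fun w h => ⟨fun s => w.1^[(s : ℕ)] w.2,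
          fun s t hst => Fin.ext (h.1 s t (by omega) (by omega) hst), rfl, fun d => ?_⟩
        simp only [id, tgt]
        rw [← iterate_succ_apply' w.1]
        split_ifs with hd
        · rfl
        · rw [show (d : ℕ).succ = j + p by omega, h.2]
    _ ≤ _ := pr_pattern_le injective_id tgt S _ hS
    _ ≤ (Fintype.card X : ℝ) ^ k * (((Fintype.card X : ℝ) ^ k)⁻¹ *
          (Fintype.card X : ℝ)⁻¹) := by
        have := card_embedding_le_pow (X := X) (Fin k)
        rw [Fintype.card_fin] at this ⊢
        gcongr
    _ = 1 / Fintype.card X := by field_simp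

theorem pr_isLong_le (L : ℕ) :
    pr (fun w : (X → X) × X => IsLong w.1 w.2 L) ≤
      ((Fintype.card X).descFactorial (L + 1) : ℝ) / (Fintype.card X : ℝ) ^ (L + 1) := by
  have hn := card_pos_real (X := X)
  calc _ ≤ pr (fun w : (X → X) × X => ∃ v : Fin (L + 1) → X, Injective v ∧
          (fun (v : Fin (L + 1) → X) x => x = v 0) v w.2 ∧
          ∀ d : Fin L, w.1 (v d.castSucc) = v d.succ) := by
        refine pr_mono fun w h => ⟨fun s => w.1^[(s : ℕ)] w.2,
          fun s t hst => Fin.ext (h s t (by omega) (by omega) hst), rfl, fun d => ?_⟩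
        simp only [Fin.val_castSucc, Fin.val_succ]
        rw [← iterate_succ_apply' w.1]
    _ ≤ _ := pr_pattern_le (Fin.castSucc_injective L) _ _ _ fun v => (pr_eq_point _).le
    _ = _ := by
        rw [Fintype.card_embedding_eq, Fintype.card_fin, Fintype.card_fin, pow_succ]
        field_simp

/-- The trajectories of `x` and `y` meet within `M` steps, before becoming periodic. -/
def Meet (a : X → X) (M : ℕ) (x y : X) : Prop :=
  (∀ t < M, a^[t] x ∉ cyc a) ∧ (∀ t < M, a^[t] y ∉ cyc a) ∧
    ∃ i < M, ∃ j < M, a^[i] x = a^[j] y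

theorem pr_first_meet_le (i j : ℕ) :
    pr (fun w : (X → X) × (X × X) =>
      (∀ s t, s ≤ i → t ≤ i → w.1^[s] w.2.1 = w.1^[t] w.2.1 → s = t) ∧
      (∀ s t, s < j → t < j → w.1^[s] w.2.2 = w.1^[t] w.2.2 → s = t) ∧
      (∀ s t, s ≤ i → t < j → w.1^[s] w.2.1 ≠ w.1^[t] w.2.2) ∧
      w.1^[i] w.2.1 = w.1^[j] w.2.2) ≤ 1 / Fintype.card X := by
  have hn := card_pos_real (X := X)
  let nxt : ℕ → Fin (i + 1) ⊕ Fin j := fun t =>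
    if h : t < j then Sum.inr ⟨t, h⟩ else Sum.inl (Fin.last i)
  calc _ ≤ pr (fun w : (X → X) × (X × X) => ∃ v : Fin (i + 1) ⊕ Fin j → X, Injective v ∧
          (fun (v : Fin (i + 1) ⊕ Fin j → X) (z : X × X) =>
            z.1 = v (Sum.inl 0) ∧ z.2 = v (nxt 0)) v w.2 ∧
          ∀ d : Fin i ⊕ Fin j, w.1 (v (Sum.map Fin.castSucc id d)) =
            v (Sum.elim (fun s => Sum.inl s.succ) (fun t : Fin j => nxt (t + 1)) d)) := by
        refine pr_mono fun w ⟨h1, h2, h3, h4⟩ => ?_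
        have hnxt : ∀ t ≤ j, Sum.elim (fun s : Fin (i + 1) => w.1^[(s : ℕ)] w.2.1)
            (fun t : Fin j => w.1^[(t : ℕ)] w.2.2) (nxt t) = w.1^[t] w.2.2 := fun t ht => by
          by_cases h : t < j
          · simp [nxt, h]
          · rw [show t = j by omega, ← h4]; simp [nxt]
        refine ⟨Sum.elim (fun s : Fin (i + 1) => w.1^[(s : ℕ)] w.2.1)
          (fun t : Fin j => w.1^[(t : ℕ)] w.2.2), ?_, ⟨rfl, (hnxt 0 (Nat.zero_le _)).symm⟩, ?_⟩
        · refine Injective.sumElim (fun s t h => Fin.ext (h1 s t (by omega) (by omega) h))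
            (fun s t h => Fin.ext (h2 s t s.2 t.2 h)) fun s t => h3 s t (by omega) t.2
        · rintro (d | d)
          · simp only [Sum.map_inl, Sum.elim_inl, Fin.val_castSucc, Fin.val_succ]
            rw [← iterate_succ_apply' w.1]
          · simp only [Sum.map_inr, Sum.elim_inr, id]
            rw [hnxt _ (by omega), ← iterate_succ_apply' w.1]
    _ ≤ _ := pr_pattern_le (Injective.sumMap (Fin.castSucc_injective i) injective_id) _ _ _
          fun v => (pr_eq_point_pair _ _).le
    _ ≤ (Fintype.card X : ℝ) ^ (i + 1 + j) * (((Fintype.card X : ℝ) ^ (i + j))⁻¹ *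
          ((Fintype.card X : ℝ)⁻¹ * (Fintype.card X : ℝ)⁻¹)) := by
        have := card_embedding_le_pow (X := X) (Fin (i + 1) ⊕ Fin j)
        rw [Fintype.card_sum, Fintype.card_fin, Fintype.card_fin] at this
        rw [Fintype.card_sum, Fintype.card_fin, Fintype.card_fin]
        gcongr
    _ = 1 / Fintype.card X := by
        rw [show i + 1 + j = i + j + 1 by ring, pow_succ]
        field_simp

theorem pr_meet_le (M : ℕ) :
    pr (fun w : (X → X) × (X × X) => Meet w.1 M w.2.1 w.2.2) ≤ M * M / Fintype.card X := by
  have hinj : ∀ {a : X → X} {x : X}, (∀ t < M, a^[t] x ∉ cyc a) →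
      ∀ s t, s < M → t < M → a^[s] x = a^[t] x → s = t := by
    intro a x h s t hs ht hst
    rcases lt_trichotomy s t with hlt | heq | hlt
    · exact absurd (mem_cyc_of_iterate_eq hlt hst) (h s hs)
    · exact heq
    · exact absurd (mem_cyc_of_iterate_eq hlt hst.symm) (h t ht)
  calc _ ≤ pr (fun w : (X → X) × (X × X) => ∃ k ∈ range M ×ˢ range M,
      (∀ s t, s ≤ k.1 → t ≤ k.1 → w.1^[s] w.2.1 = w.1^[t] w.2.1 → s = t) ∧
      (∀ s t, s < k.2 → t < k.2 → w.1^[s] w.2.2 = w.1^[t] w.2.2 → s = t) ∧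
      (∀ s t, s ≤ k.1 → t < k.2 → w.1^[s] w.2.1 ≠ w.1^[t] w.2.2) ∧
      w.1^[k.1] w.2.1 = w.1^[k.2] w.2.2) := by
        refine pr_mono fun w ⟨hx, hy, i, hi, j, hj, h⟩ => ?_
        have hex : ∃ j, j < M ∧ ∃ i < M, w.1^[i] w.2.1 = w.1^[j] w.2.2 := ⟨j, hj, i, hi, h⟩
        obtain ⟨hj', i', hi', h'⟩ := Nat.find_spec hex
        refine ⟨(i', Nat.find hex), by simp [hi', hj'], fun s t hs ht => ?_, fun s t hs ht => ?_,
          fun s t hs ht he => ?_, h'⟩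
        · dsimp only at hs ht
          exact hinj hx s t (by omega) (by omega)
        · dsimp only at hs ht
          exact hinj hy s t (by omega) (by omega)
        · dsimp only at hs ht
          exact Nat.find_min hex ht ⟨by omega, s, by omega, he⟩
    _ ≤ ∑ k ∈ range M ×ˢ range M, _ := pr_exists_le _ _
    _ ≤ ∑ k ∈ range M ×ˢ range M, 1 / (Fintype.card X : ℝ) :=
        sum_le_sum fun k _ => pr_first_meet_le k.1 k.2
    _ = _ := by
        rw [sum_const, card_product, card_range, nsmul_eq_mul]
        push_cast
        ring

theorem pr_card_cyc_eq_le (k : ℕ) :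
    pr (fun a : X → X => #(cyc a) = k) ≤
      ((Fintype.card X).descFactorial k : ℝ) / (Fintype.card X : ℝ) ^ k := by
  have hn := card_pos_real (X := X)
  calc _ ≤ pr (fun a : X → X => ∃ s ∈ powersetCard k (univ : Finset X),
        ∃ τ ∈ (univ : Finset (Equiv.Perm s)), ∀ x : s, a x = τ x) := by
        refine pr_mono fun a h => ⟨cyc a, mem_powersetCard.2 ⟨subset_univ _, h⟩, ?_⟩
        let f : cyc a → cyc a := fun x => ⟨a x, iterate_mem_cyc x.2 1⟩
        have hf : Injective f := fun x y hxy =>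
          Subtype.ext (injOn_cyc x.2 y.2 (congrArg Subtype.val hxy))
        exact ⟨Equiv.ofBijective f (Finite.injective_iff_bijective.1 hf), mem_univ _,
          fun x => rfl⟩
    _ ≤ ∑ s ∈ powersetCard k (univ : Finset X), ∑ τ : Equiv.Perm s,
          pr (fun a : X → X => ∀ x : s, a x = τ x) :=
        (pr_exists_le _ _).trans (sum_le_sum fun s _ => pr_exists_le _ _)
    _ = ∑ s ∈ powersetCard k (univ : Finset X), (k.factorial : ℝ) *
          ((Fintype.card X : ℝ) ^ k)⁻¹ := by
        refine sum_congr rfl fun s hs => ?_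
        have hk := (mem_powersetCard.1 hs).2
        have : ∀ τ : Equiv.Perm s, pr (fun a : X → X => ∀ x : s, a x = τ x) =
            ((Fintype.card X : ℝ) ^ k)⁻¹ := fun τ => by
          rw [pr_eq_const_of_injective (e := fun x : s => (x : X)) Subtype.val_injective,
            Fintype.card_coe, hk]
        simp only [this, sum_const, card_univ, nsmul_eq_mul]
        rw [Fintype.card_perm, Fintype.card_coe, hk]
    _ = _ := by
        rw [sum_const, card_powersetCard, card_univ, nsmul_eq_mul,
          Nat.descFactorial_eq_factorial_mul_choose]
        push_cast
        ring

theorem descFactorial_div_pow_le {n : ℕ} (hn : 0 < n) {L k : ℕ} (hk : L + 1 ≤ k) :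
    (n.descFactorial k : ℝ) / (n : ℝ) ^ k ≤ Real.exp (-((L : ℝ) ^ 2 / (2 * n))) := by
  have hn' : (0 : ℝ) < n := by exact_mod_cast hn
  have hk' : (L : ℝ) + 1 ≤ k := by exact_mod_cast hk
  have h1 : (n.descFactorial k : ℝ) / (n : ℝ) ^ k = ∏ i ∈ range k, (((n - i : ℕ) : ℝ) / n) := by
    rw [Nat.descFactorial_eq_prod_range, prod_div_distrib, prod_const, card_range, Nat.cast_prod]
  have h2 : (∑ i ∈ range k, (i : ℝ)) * 2 = k * (k - 1) := by
    have := Finset.sum_range_id_mul_two k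
    have h : ((∑ i ∈ range k, i : ℕ) : ℝ) * 2 = (k * (k - 1 : ℕ) : ℕ) := by exact_mod_cast this
    rw [Nat.cast_mul, Nat.cast_sub (by omega)] at h
    simpa using h
  rw [h1]
  calc _ ≤ ∏ i ∈ range k, Real.exp (-((i : ℝ) / n)) := by
        refine prod_le_prod (fun i _ => by positivity) fun i _ => ?_
        have h3 := Real.add_one_le_exp (-((i : ℝ) / n))
        rcases le_total i n with hi | hi
        · rw [Nat.cast_sub hi, sub_div, div_self hn'.ne']
          linarith
        · rw [Nat.sub_eq_zero_of_le hi]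
          simp only [Nat.cast_zero, zero_div]
          positivity
    _ = Real.exp (-((∑ i ∈ range k, (i : ℝ)) / n)) := by
        rw [← Real.exp_sum, sum_neg_distrib, sum_div]
    _ ≤ _ := by
        rw [Real.exp_le_exp, neg_le_neg_iff, div_le_div_iff₀ (by positivity) hn']
        have hL : (0 : ℝ) ≤ L := by positivity
        nlinarith [mul_le_mul_of_nonneg_left (show (L : ℝ) ^ 2 ≤ k * (k - 1) by nlinarith) hn'.le]

end Trajectories

section FirstLetter

open Function

variable {X : Type*} [Fintype X] [DecidableEq X]

/-- An upper bound for the probability that a uniform random self-map of `X` has a trajectory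
whose first `L + 1` points are distinct. -/
noncomputable def tail (X : Type*) [Fintype X] (L : ℕ) : ℝ :=
  Real.exp (-((L : ℝ) ^ 2 / (2 * Fintype.card X)))

/-- The cyclic points lying on cycles of length at most `m`. -/
noncomputable def shortCyc (a : X → X) (m : ℕ) : Finset X := {c ∈ cyc a | minimalPeriod a c ≤ m}

theorem mem_shortCyc {a : X → X} {m : ℕ} {c : X} :
    c ∈ shortCyc a m ↔ c ∈ cyc a ∧ minimalPeriod a c ≤ m := by simp [shortCyc]

theorem iterate_mem_shortCyc {a : X → X} {m : ℕ} {c : X} (hc : c ∈ cyc a) (t : ℕ) :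
    a^[t] c ∈ shortCyc a m ↔ c ∈ shortCyc a m := by
  rw [mem_shortCyc, mem_shortCyc, minimalPeriod_apply_iterate (mem_cyc.1 hc)]
  simp [hc, iterate_mem_cyc hc]

variable [Nonempty X]

theorem pr_isLong_le_tail (L : ℕ) :
    pr (fun w : (X → X) × X => IsLong w.1 w.2 L) ≤ tail X L :=
  (pr_isLong_le L).trans (descFactorial_div_pow_le Fintype.card_pos le_rfl)

theorem pr_exists_isRho_le (J P : ℕ) :
    pr (fun w : (X → X) × X => ∃ j p, 0 < p ∧ j < J ∧ p ≤ P ∧ IsRho w.1 w.2 j p) ≤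
      J * P / Fintype.card X := by
  calc _ ≤ pr (fun w : (X → X) × X => ∃ k ∈ range J ×ˢ range P, IsRho w.1 w.2 k.1 (k.2 + 1)) := by
        refine pr_mono fun w ⟨j, p, hp, hj, hP, h⟩ => ⟨(j, p - 1), ?_, ?_⟩
        · simp only [mem_product, mem_range]; omega
        · rwa [Nat.sub_add_cancel hp]
    _ ≤ ∑ k ∈ range J ×ˢ range P, 1 / (Fintype.card X : ℝ) :=
        (pr_exists_le _ _).trans (sum_le_sum fun k _ => pr_isRho_le k.2.succ_pos)
    _ = _ := by
        rw [sum_const, card_product, card_range, card_range, nsmul_eq_mul]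
        push_cast
        ring

theorem pr_proj_mem_shortCyc_le (m L : ℕ) :
    pr (fun w : (X → X) × X => proj w.1 w.2 ∈ shortCyc w.1 m) ≤
      L * m / Fintype.card X + tail X L := by
  refine (pr_mono fun w h => ?_).trans ((pr_or_le _ _).trans
    (add_le_add (pr_exists_isRho_le L m) (pr_isLong_le_tail L)))
  obtain ⟨j, p, hp, hrho, -, hper, -⟩ := exists_isRho w.1 w.2
  have hm := (mem_shortCyc.1 h).2
  rcases lt_or_ge L (j + p) with hL | hL
  · exact Or.inr (hrho.isLong hL)
  · exact Or.inl ⟨j, p, hp, by omega, by omega, hrho⟩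

theorem pr_exists_iterate_mem_cyc_le (M L : ℕ) :
    pr (fun w : (X → X) × X => ∃ t < M, w.1^[t] w.2 ∈ cyc w.1) ≤
      M * L / Fintype.card X + tail X L := by
  refine (pr_mono fun w h => ?_).trans ((pr_or_le _ _).trans
    (add_le_add (pr_exists_isRho_le M L) (pr_isLong_le_tail L)))
  obtain ⟨j, p, hp, hrho, hj, -, -⟩ := exists_isRho w.1 w.2
  obtain ⟨t, ht, htc⟩ := h
  have := (hj t).1 htc
  rcases lt_or_ge L (j + p) with hL | hL
  · exact Or.inr (hrho.isLong hL)
  · exact Or.inl ⟨j, p, hp, by omega, by omega, hrho⟩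

theorem pr_mem_shortCyc_le (m : ℕ) :
    pr (fun w : (X → X) × X => w.2 ∈ shortCyc w.1 m) ≤ m / Fintype.card X := by
  refine (pr_mono fun w h => ?_).trans ((pr_exists_isRho_le 1 m).trans_eq (by simp))
  obtain ⟨j, p, hp, hrho, hj, hper, -⟩ := exists_isRho w.1 w.2
  obtain ⟨hc, hm⟩ := mem_shortCyc.1 h
  rw [proj_eq_self hc] at hper
  have := (hj 0).1 hc
  exact ⟨j, p, hp, by omega, by omega, hrho⟩

theorem pr_lt_card_shortCyc_le (m : ℕ) {t : ℝ} (ht : 0 < t) :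
    pr (fun a : X → X => t < #(shortCyc a m)) ≤ m / t := by
  have hn := card_pos_real (X := X)
  refine (pr_gt_le_expect_div _ (fun a => by positivity) ht).trans ?_
  have h := pr_mem_shortCyc_le (X := X) m
  rw [pr_prod] at h
  have h2 : ∀ a : X → X, pr (fun x => x ∈ shortCyc a m) =
      (#(shortCyc a m) : ℝ) / Fintype.card X := fun a => by
    rw [pr_eq_card_div]
    congr 3
    ext; simp
  simp only [h2] at h
  rw [← expect_div, div_le_div_iff_of_pos_right hn] at h
  gcongr

theorem pr_lt_pr_proj_le (m L : ℕ) {t : ℝ} (ht : 0 < t) :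
    pr (fun a : X → X => t < pr fun x => proj a x ∈ shortCyc a m) ≤
      (L * m / Fintype.card X + tail X L) / t := by
  refine (pr_gt_le_expect_div _ (fun a => pr_nonneg _) ht).trans ?_
  have h := pr_proj_mem_shortCyc_le (X := X) m L
  rw [pr_prod] at h
  gcongr

theorem pr_lt_card_cyc_le (L : ℕ) :
    pr (fun a : X → X => L < #(cyc a)) ≤ Fintype.card X * tail X L := by
  calc _ ≤ pr (fun a : X → X => ∃ k ∈ Ioc L (Fintype.card X), #(cyc a) = k) :=
        pr_mono fun a h => ⟨_, mem_Ioc.2 ⟨h, card_le_univ _⟩, rfl⟩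
    _ ≤ ∑ k ∈ Ioc L (Fintype.card X), tail X L :=
        (pr_exists_le _ _).trans (sum_le_sum fun k hk => (pr_card_cyc_eq_le k).trans
          (descFactorial_div_pow_le Fintype.card_pos (mem_Ioc.1 hk).1))
    _ ≤ _ := by
        rw [sum_const, Nat.card_Ioc, nsmul_eq_mul]
        have : ((Fintype.card X - L : ℕ) : ℝ) ≤ Fintype.card X := by exact_mod_cast Nat.sub_le _ _
        exact mul_le_mul_of_nonneg_right this (Real.exp_pos _).le

theorem inv_card_cyc_le_pr_proj_eq (a : X → X) :
    (#(cyc a) : ℝ)⁻¹ ≤ pr (fun w : X × X => proj a w.1 = proj a w.2) := by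
  have hn := card_pos_real (X := X)
  obtain ⟨x⟩ := ‹Nonempty X›
  have hc : (0 : ℝ) < #(cyc a) := by exact_mod_cast card_pos.2 ⟨_, proj_mem_cyc a x⟩
  let f : X → ℝ := fun c => #{x | proj a x = c}
  have h1 : ∑ c ∈ cyc a, f c = Fintype.card X := by
    have := card_eq_sum_card_fiberwise (f := proj a) (s := (univ : Finset X)) (t := cyc a)
      fun x _ => proj_mem_cyc a x
    rw [card_univ] at this
    rw [this]
    push_cast
    rfl
  have h2 : ∑ c ∈ cyc a, f c ^ 2 = ∑ y, f (proj a y) := by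
    rw [← sum_fiberwise_of_maps_to (s := (univ : Finset X)) (t := cyc a) (g := proj a)
      (fun x _ => proj_mem_cyc a x) fun y => f (proj a y)]
    refine sum_congr rfl fun c _ => ?_
    have h : ∀ y ∈ ({y | proj a y = c} : Finset X), f (proj a y) = f c := fun y hy => by
      rw [(mem_filter.1 hy).2]
    refine Eq.trans ?_ (sum_congr rfl h).symm
    rw [sum_const, nsmul_eq_mul, sq]
  have h3 : pr (fun w : X × X => proj a w.1 = proj a w.2) =
      (∑ y, f (proj a y)) / Fintype.card X / Fintype.card X := by
    rw [pr_prod, Fintype.expect_eq_sum_div_card, sum_div univ (fun y => f (proj a y))]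
    congr 1
    refine sum_congr rfl fun y _ => ?_
    rw [pr_eq_card_div]
    simp only [f]
    congr 3
    ext z
    simp [eq_comm]
  have h4 := sq_sum_le_card_mul_sum_sq (s := cyc a) (f := f)
  rw [h1, h2] at h4
  rw [h3, inv_eq_one_div, div_div, div_le_div_iff₀ hc (by positivity)]
  nlinarith

end FirstLetter

section Merging

open Function

theorem isSynchronizing_of_forall_pair {n : ℕ} {A : Type} [Fintype A] [DecidableEq A]
    (hn : 0 < n) (δ : Fin n → A → Fin n) (h : ∀ x y, ∃ w, act δ w x = act δ w y) :
    IsSynchronizing δ := by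
  have happ : ∀ (v w : List A) x, act δ (v ++ w) x = act δ w (act δ v x) := by
    intro v
    induction v with
    | nil => intro w x; rfl
    | cons c v ih => intro w x; exact ih w _
  have key : ∀ k : ℕ, ∀ w : List A, #(univ.image (act δ w)) ≤ k + 1 → IsSynchronizing δ := by
    intro k
    induction k with
    | zero =>
      intro w hw
      refine ⟨w, act δ w ⟨0, hn⟩, fun q => ?_⟩
      exact card_le_one.1 hw _ (mem_image_of_mem _ (mem_univ _)) _
        (mem_image_of_mem _ (mem_univ _))
    | succ k ih =>
      intro w hw
      by_cases hx : ∀ q, act δ w q = act δ w ⟨0, hn⟩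
      · exact ⟨w, _, hx⟩
      obtain ⟨q, hq⟩ := not_forall.1 hx
      obtain ⟨v, hv⟩ := h (act δ w q) (act δ w ⟨0, hn⟩)
      refine ih (w ++ v) ?_
      have himg : univ.image (act δ (w ++ v)) = (univ.image (act δ w)).image (act δ v) := by
        rw [image_image]
        exact image_congr fun x _ => happ w v x
      rw [himg]
      have hlt : #((univ.image (act δ w)).image (act δ v)) < #(univ.image (act δ w)) := by
        refine lt_of_le_of_ne card_image_le fun he => hq ?_
        exact card_image_iff.1 he (by simp) (by simp) hv
      omega
  exact key _ [] (Nat.le_succ _)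

variable {X : Type*} [Fintype X] [DecidableEq X]

/-- If cyclic points of `a` on short cycles are sent to longer cycles, pairs of distinct cyclic
points on longer cycles can be sent to long cycles, and pairs of distinct points on long cycles can
be merged, then all pairs can be merged. -/
theorem related_of_merging {a b : X → X} {m₀ m : ℕ} (hm₀ : 0 < m₀) (hm : m₀ ≤ m)
    (h₁ : ∀ c ∈ shortCyc a m₀, proj a (b c) ∉ shortCyc a m₀)
    (h₂ : ∀ c ∈ cyc a, ∀ d ∈ cyc a, c ∉ shortCyc a m₀ → d ∉ shortCyc a m₀ → c ≠ d →
      ∃ l, proj a (b (a^[l] c)) ∉ shortCyc a m ∧ proj a (b (a^[l] d)) ∉ shortCyc a m)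
    (h₃ : ∀ c ∈ cyc a, ∀ d ∈ cyc a, c ∉ shortCyc a m → d ∉ shortCyc a m → c ≠ d →
      ∃ l j, proj a (b (a^[j] (b (a^[l] c)))) = proj a (b (a^[j] (b (a^[l] d)))))
    (R : X → X → Prop) (hrefl : ∀ x, R x x) (hsymm : ∀ x y, R x y → R y x)
    (ha : ∀ x y, R (a x) (a y) → R x y) (hb : ∀ x y, R (b x) (b y) → R x y) (x y : X) :
    R x y := by
  have hit : ∀ t x y, R (a^[t] x) (a^[t] y) → R x y := by
    intro t
    induction t with
    | zero => exact fun x y h => h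
    | succ t ih => exact fun x y h => ha x y (ih _ _ h)
  have hproj : ∀ x y, R (proj a x) (proj a y) → R x y := hit _
  have hbl : ∀ l x y, R (proj a (b (a^[l] x))) (proj a (b (a^[l] y))) → R x y :=
    fun l x y h => hit l _ _ (hb _ _ (hproj _ _ h))
  have hsub : ∀ c, c ∉ shortCyc a m → c ∉ shortCyc a m₀ := fun c hc h =>
    hc (mem_shortCyc.2 ⟨(mem_shortCyc.1 h).1, (mem_shortCyc.1 h).2.trans hm⟩)
  have hlong : ∀ c ∈ cyc a, ∀ d ∈ cyc a, c ∉ shortCyc a m → d ∉ shortCyc a m → R c d := by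
    intro c hc d hd hcm hdm
    by_cases hcd : c = d
    · rw [hcd]; exact hrefl d
    obtain ⟨l, j, h⟩ := h₃ c hc d hd hcm hdm hcd
    refine hit l _ _ (hb _ _ (hit j _ _ (hb _ _ (hproj _ _ ?_))))
    rw [h]; exact hrefl _
  have hmid : ∀ c ∈ cyc a, ∀ d ∈ cyc a, c ∉ shortCyc a m₀ → d ∉ shortCyc a m₀ → R c d := by
    intro c hc d hd hcm hdm
    by_cases hcd : c = d
    · rw [hcd]; exact hrefl d
    obtain ⟨l, h, h'⟩ := h₂ c hc d hd hcm hdm hcd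
    exact hbl l _ _ (hlong _ (proj_mem_cyc _ _) _ (proj_mem_cyc _ _) h h')
  have hmix : ∀ c ∈ shortCyc a m₀, ∀ d ∈ cyc a, d ∉ shortCyc a m₀ → R c d := by
    intro c hc d hd hdm
    have had : d ≠ a d := fun h => hdm (mem_shortCyc.2 ⟨hd, by
      have : IsPeriodicPt a 1 d := by simpa [IsPeriodicPt, IsFixedPt] using h.symm
      have := this.minimalPeriod_le one_pos
      omega⟩)
    obtain ⟨l, h, -⟩ := h₂ d hd (a d) (iterate_mem_cyc hd 1) hdm
      ((iterate_mem_shortCyc hd 1).not.2 hdm) had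
    have hcl := (iterate_mem_shortCyc (mem_shortCyc.1 hc).1 l).2 hc
    exact hbl l _ _ (hmid _ (proj_mem_cyc _ _) _ (proj_mem_cyc _ _) (h₁ _ hcl) (hsub _ h))
  refine hproj x y ?_
  generalize hc : proj a x = c
  generalize hd : proj a y = d
  have hcc : c ∈ cyc a := hc ▸ proj_mem_cyc a x
  have hdc : d ∈ cyc a := hd ▸ proj_mem_cyc a y
  by_cases hc₀ : c ∈ shortCyc a m₀ <;> by_cases hd₀ : d ∈ shortCyc a m₀
  · exact hb _ _ (hproj _ _ (hmid _ (proj_mem_cyc _ _) _ (proj_mem_cyc _ _) (h₁ _ hc₀) (h₁ _ hd₀)))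
  · exact hmix c hc₀ d hdc hd₀
  · exact hsymm _ _ (hmix d hd₀ c hcc hc₀)
  · exact hmid c hcc d hdc hc₀ hd₀

end Merging

section SecondLetter

open Function

variable {X : Type*} [Fintype X] [DecidableEq X]

/-- Any family of pairs with distinct first and distinct second coordinates contains a third of its
members on which first and second coordinates are pairwise different. -/
theorem exists_disjoint_subfamily {ι : Type*} (u v : ι → X) (T : Finset ι) (hu : Set.InjOn u T)
    (hv : Set.InjOn v T) (huv : ∀ l ∈ T, u l ≠ v l) :
    ∃ S ⊆ T, #T ≤ 3 * #S ∧ ∀ l ∈ S, ∀ l' ∈ S, u l ≠ v l' := by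
  induction T using Finset.strongInduction with
  | H T ih =>
    rcases T.eq_empty_or_nonempty with rfl | ⟨l, hl⟩
    · exact ⟨∅, by simp⟩
    let T' := {l' ∈ T | l' ≠ l ∧ u l' ≠ v l ∧ v l' ≠ u l}
    have hT' : T' ⊂ T := (filter_ssubset).2 ⟨l, hl, by simp⟩
    obtain ⟨S, hS, hcard, hdisj⟩ := ih T' hT' (hu.mono (coe_subset.2 hT'.1))
      (hv.mono (coe_subset.2 hT'.1)) fun l' h => huv l' (hT'.1 h)
    have hlS : l ∉ S := fun h => (mem_filter.1 (hS h)).2.1 rfl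
    refine ⟨insert l S, insert_subset hl (hS.trans hT'.1), ?_, ?_⟩
    · rw [card_insert_of_notMem hlS]
      have hsub : T ⊆ T' ∪ ({l} ∪ ({l' ∈ T | u l' = v l} ∪ {l' ∈ T | v l' = u l})) := by
        intro l' h
        simp only [T', mem_union, mem_filter, mem_singleton]
        tauto
      have h1 : #{l' ∈ T | u l' = v l} ≤ 1 := card_le_one.2 fun x hx y hy => by
        rw [mem_filter] at hx hy
        exact hu hx.1 hy.1 (hx.2.trans hy.2.symm)
      have h2 : #{l' ∈ T | v l' = u l} ≤ 1 := card_le_one.2 fun x hx y hy => by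
        rw [mem_filter] at hx hy
        exact hv hx.1 hy.1 (hx.2.trans hy.2.symm)
      have h3 := card_le_card hsub
      have h4 := card_union_le T' ({l} ∪ ({l' ∈ T | u l' = v l} ∪ {l' ∈ T | v l' = u l}))
      have h5 := card_union_le {l} ({l' ∈ T | u l' = v l} ∪ {l' ∈ T | v l' = u l})
      have h6 := card_union_le {l' ∈ T | u l' = v l} {l' ∈ T | v l' = u l}
      rw [card_singleton] at h5
      omega
    · intro x hx y hy
      rw [mem_insert] at hx hy
      rcases hx with rfl | hx <;> rcases hy with rfl | hy
      · exact huv _ hl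
      · exact (mem_filter.1 (hS hy)).2.2.2.symm
      · exact (mem_filter.1 (hS hx)).2.2.1
      · exact hdisj x hx y hy

variable [Nonempty X]

theorem pr_forall_mem_le {ι : Type*} (T : Finset ι) (u v : ι → X) (hu : Set.InjOn u T)
    (hv : Set.InjOn v T) (huv : ∀ l ∈ T, u l ≠ v l) (p : X → X → Prop) {r : ℝ} (hr : 0 ≤ r)
    (hp : pr (fun w : X × X => p w.1 w.2) ≤ Real.exp (-r)) :
    pr (fun g : X → X => ∀ l ∈ T, p (g (u l)) (g (v l))) ≤ Real.exp (-(r * #T / 3)) := by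
  obtain ⟨S, hST, hcard, hS⟩ := exists_disjoint_subfamily u v T hu hv huv
  have hcard' : (#T : ℝ) ≤ 3 * #S := by exact_mod_cast hcard
  calc _ ≤ pr (fun g : X → X => ∀ l : S, p (g (u l)) (g (v l))) :=
        pr_mono fun g h l => h l (hST l.2)
    _ = pr (fun w : X × X => p w.1 w.2) ^ Fintype.card S :=
        pr_forall_pairs (u := fun l : S => u l) (v := fun l : S => v l)
          (fun x y h => Subtype.ext (hu (hST x.2) (hST y.2) h))
          (fun x y h => Subtype.ext (hv (hST x.2) (hST y.2) h))
          (fun x y => hS x x.2 y y.2) p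
    _ ≤ Real.exp (-r) ^ #S := by
        rw [Fintype.card_coe]
        exact pow_le_pow_left₀ (pr_nonneg _) hp _
    _ ≤ _ := by
        rw [← Real.exp_nat_mul, Real.exp_le_exp]
        nlinarith

theorem iterate_injOn_range {a : X → X} {c : X} {m : ℕ} (hc : c ∈ cyc a)
    (hcm : c ∉ shortCyc a m) : Set.InjOn (fun l : ℕ => a^[l] c) (range m) := by
  have hm : m < minimalPeriod a c := not_le.1 fun h => hcm (mem_shortCyc.2 ⟨hc, h⟩)
  intro l hl l' hl' h
  rw [coe_range, Set.mem_Iio] at hl hl'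
  exact (iterate_eq_iterate_iff_of_lt_minimalPeriod (by omega) (by omega)).1 h

theorem pr_exists_pair_le (p : X → X → (X → X) → Prop) {r : ℝ} (h : ∀ c d, pr (p c d) ≤ r) :
    pr (fun b => ∃ c d, p c d b) ≤ (Fintype.card X : ℝ) ^ 2 * r := by
  calc _ ≤ pr (fun b => ∃ w ∈ (univ : Finset (X × X)), p w.1 w.2 b) :=
        pr_mono fun b ⟨c, d, h⟩ => ⟨(c, d), mem_univ _, h⟩
    _ ≤ ∑ w : X × X, r := (pr_exists_le _ _).trans (sum_le_sum fun w _ => h _ _)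
    _ = _ := by
        rw [sum_const, card_univ, Fintype.card_prod, nsmul_eq_mul]
        push_cast
        ring

theorem pr_not_sent_to_long_le (a : X → X) (m₀ m : ℕ)
    (ha : pr (fun x => proj a x ∈ shortCyc a m) ≤ 1 / 4) :
    pr (fun b : X → X => ∃ c d, (c ∈ cyc a ∧ d ∈ cyc a ∧ c ∉ shortCyc a m₀ ∧
      d ∉ shortCyc a m₀ ∧ c ≠ d) ∧ ∀ l, proj a (b (a^[l] c)) ∈ shortCyc a m ∨
        proj a (b (a^[l] d)) ∈ shortCyc a m) ≤
      (Fintype.card X : ℝ) ^ 2 * Real.exp (-(m₀ / 6)) := by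
  refine pr_exists_pair_le _ fun c d => ?_
  by_cases hcd : c ∈ cyc a ∧ d ∈ cyc a ∧ c ∉ shortCyc a m₀ ∧ d ∉ shortCyc a m₀ ∧ c ≠ d
  swap
  · simp only [hcd, false_and]
    rw [pr_eq_zero fun _ => id]
    positivity
  obtain ⟨hc, hd, hcm, hdm, hne⟩ := hcd
  have hexp : (1 / 2 : ℝ) ≤ Real.exp (-(1 / 2)) := by
    have := Real.add_one_le_exp (-(1 / 2 : ℝ))
    linarith
  calc _ ≤ pr (fun b : X → X => ∀ l ∈ range m₀, proj a (b (a^[l] c)) ∈ shortCyc a m ∨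
        proj a (b (a^[l] d)) ∈ shortCyc a m) := pr_mono fun b h l _ => h.2 l
    _ ≤ Real.exp (-(1 / 2 * #(range m₀) / 3)) := by
        refine pr_forall_mem_le (range m₀) (fun l => a^[l] c) (fun l => a^[l] d)
          (iterate_injOn_range hc hcm) (iterate_injOn_range hd hdm)
          (fun l _ h => hne (iterate_injOn_cyc l hc hd h))
          (fun x y => proj a x ∈ shortCyc a m ∨ proj a y ∈ shortCyc a m) (by norm_num) ?_
        refine (pr_or_le _ _).trans ?_
        have h1 := pr_fst (β := X) fun x => proj a x ∈ shortCyc a m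
        have h2 := pr_equiv (Equiv.prodComm X X) fun w : X × X => proj a w.1 ∈ shortCyc a m
        simp only [Equiv.prodComm_apply, Prod.fst_swap] at h2
        rw [h2, h1]
        linarith
    _ = _ := by
        rw [card_range]
        ring_nf

end SecondLetter

section UnionBound

open Function

variable {X : Type*} [Fintype X] [DecidableEq X]

/-- The cyclic points `c` of `a` for which the `a`-trajectory of `b c` reaches a cycle, or the
trajectory of `b c'` for another cyclic point `c'`, within `M` steps. -/
noncomputable def exceptional (M : ℕ) (a b : X → X) : Finset X :=
  {c ∈ cyc a | (∃ t < M, a^[t] (b c) ∈ cyc a) ∨ ∃ c' ∈ cyc a, c' ≠ c ∧ Meet a M (b c) (b c')}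

theorem exceptional_congr {M : ℕ} {a b b' : X → X} (h : ∀ c ∈ cyc a, b c = b' c) :
    exceptional M a b = exceptional M a b' := by
  ext c
  simp only [exceptional, mem_filter]
  refine and_congr_right fun hc => ?_
  rw [h c hc]
  refine or_congr_right (exists_congr fun c' => and_congr_right fun hc' => ?_)
  rw [h c' hc']

theorem iterate_notMem_cyc_of_notMem_exceptional {M : ℕ} {a b : X → X} {c : X} (hc : c ∈ cyc a)
    (h : c ∉ exceptional M a b) {t : ℕ} (ht : t < M) : a^[t] (b c) ∉ cyc a := fun h' =>
  h (mem_filter.2 ⟨hc, Or.inl ⟨t, ht, h'⟩⟩)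

theorem iterate_ne_of_notMem_exceptional {M : ℕ} {a b : X → X} {c d : X} (hc : c ∈ cyc a)
    (hd : d ∈ cyc a) (hcd : c ≠ d) (hce : c ∉ exceptional M a b) (hde : d ∉ exceptional M a b)
    {s t : ℕ} (hs : s < M) (ht : t < M) : a^[s] (b c) ≠ a^[t] (b d) := fun h =>
  hce (mem_filter.2 ⟨hc, Or.inr ⟨d, hd, hcd.symm,
    fun _ => iterate_notMem_cyc_of_notMem_exceptional hc hce,
    fun _ => iterate_notMem_cyc_of_notMem_exceptional hd hde, s, hs, t, ht, h⟩⟩)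

variable [Nonempty X]

theorem pr_short_sent_to_short_le (m₀ L : ℕ) {t : ℝ} (ht : 0 ≤ t) :
    pr (fun w : (X → X) × (X → X) => (#(shortCyc w.1 m₀) : ℝ) ≤ t ∧
      ∃ c ∈ shortCyc w.1 m₀, proj w.1 (w.2 c) ∈ shortCyc w.1 m₀) ≤
      t * (L * m₀ / Fintype.card X + tail X L) := by
  have h := pr_proj_mem_shortCyc_le (X := X) m₀ L
  rw [pr_prod] at h
  refine (pr_prod_le (fun a b : X → X => (#(shortCyc a m₀) : ℝ) ≤ t ∧
    ∃ c ∈ shortCyc a m₀, proj a (b c) ∈ shortCyc a m₀)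
    (fun a => t * pr fun x => proj a x ∈ shortCyc a m₀) fun a => ?_).trans ?_
  · by_cases ha : (#(shortCyc a m₀) : ℝ) ≤ t
    · simp only [ha, true_and]
      refine (pr_exists_le _ _).trans ?_
      rw [sum_congr rfl fun c _ => pr_eval c fun x => proj a x ∈ shortCyc a m₀, sum_const,
        nsmul_eq_mul]
      exact mul_le_mul_of_nonneg_right ha (pr_nonneg _)
    · simp only [ha, false_and]
      rw [pr_eq_zero fun _ => id]
      exact mul_nonneg ht (pr_nonneg _)
  · rw [← mul_expect]
    exact mul_le_mul_of_nonneg_left h ht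

theorem expect_card_exceptional_le (M L : ℕ) (a : X → X) (ha : #(cyc a) ≤ L) :
    𝔼 b : X → X, (#(exceptional M a b) : ℝ) ≤
      L * (pr (fun x => ∃ t < M, a^[t] x ∈ cyc a) + L * pr fun w : X × X => Meet a M w.1 w.2) := by
  have ha' : (#(cyc a) : ℝ) ≤ L := by exact_mod_cast ha
  have h1 := pr_nonneg fun x => ∃ t < M, a^[t] x ∈ cyc a
  have h2 := pr_nonneg fun w : X × X => Meet a M w.1 w.2
  calc _ = ∑ c ∈ cyc a, pr fun b : X → X => (∃ t < M, a^[t] (b c) ∈ cyc a) ∨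
        ∃ c' ∈ cyc a, c' ≠ c ∧ Meet a M (b c) (b c') := by
        rw [← expect_sum_ite]
        refine expect_congr rfl fun b _ => ?_
        rw [exceptional]
        congr 2
        ext c
        simp
    _ ≤ ∑ c ∈ cyc a, (pr (fun x => ∃ t < M, a^[t] x ∈ cyc a) +
        L * pr fun w : X × X => Meet a M w.1 w.2) := by
        refine sum_le_sum fun c _ => (pr_or_le _ _).trans (add_le_add ?_ ?_)
        · rw [pr_eval c fun x => ∃ t < M, a^[t] x ∈ cyc a]
        · refine (pr_exists_le _ _).trans ?_
          calc _ ≤ ∑ c' ∈ cyc a, pr fun w : X × X => Meet a M w.1 w.2 := by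
                refine sum_le_sum fun c' _ => ?_
                by_cases hc : c' = c
                · simp only [hc, ne_eq, not_true, false_and]
                  rw [pr_eq_zero fun _ => id]
                  exact h2
                · rw [← pr_eval_pair (Ne.symm hc) fun x y => Meet a M x y]
                  exact pr_mono fun b h => h.2
            _ ≤ _ := by
                rw [sum_const, nsmul_eq_mul]
                exact mul_le_mul_of_nonneg_right ha' h2
    _ ≤ _ := by
        rw [sum_const, nsmul_eq_mul]
        exact mul_le_mul_of_nonneg_right ha' (by positivity)

theorem pr_lt_card_exceptional_le (M L : ℕ) {t : ℝ} (ht : 0 < t) :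
    pr (fun w : (X → X) × (X → X) => #(cyc w.1) ≤ L ∧ t < #(exceptional M w.1 w.2)) ≤
      L * (M * L / Fintype.card X + tail X L + L * (M * M / Fintype.card X)) / t := by
  have h1 := pr_exists_iterate_mem_cyc_le (X := X) M L
  have h2 := pr_meet_le (X := X) M
  rw [pr_prod] at h1 h2
  refine (pr_prod_le (fun a b : X → X => #(cyc a) ≤ L ∧ t < #(exceptional M a b))
    (fun a => L * (pr (fun x => ∃ t < M, a^[t] x ∈ cyc a) +
      L * pr fun w : X × X => Meet a M w.1 w.2) / t) fun a => ?_).trans ?_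
  · by_cases ha : #(cyc a) ≤ L
    · simp only [ha, true_and]
      refine (pr_gt_le_expect_div _ (fun b => by positivity) ht).trans ?_
      exact div_le_div_of_nonneg_right (expect_card_exceptional_le M L a ha) ht.le
    · simp only [ha, false_and]
      rw [pr_eq_zero fun _ => id]
      have h1 := pr_nonneg fun x => ∃ t < M, a^[t] x ∈ cyc a
      have h2 := pr_nonneg fun w : X × X => Meet a M w.1 w.2
      positivity
  · rw [← expect_div, ← mul_expect, expect_add_distrib, ← mul_expect]
    gcongr

theorem pr_not_merged_of_exceptional_le (a b : X → X) {M L m : ℕ} (hL : #(cyc a) ≤ L)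
    (hb : 4 * #(exceptional M a b) ≤ m) {c d : X} (hc : c ∈ cyc a) (hd : d ∈ cyc a)
    (hcm : c ∉ shortCyc a m) (hdm : d ∉ shortCyc a m) (hcd : c ≠ d) :
    pr (fun b' : X → X => ∀ l j, proj a ((cyc a).piecewise b b' (a^[j] (b (a^[l] c)))) ≠
      proj a ((cyc a).piecewise b b' (a^[j] (b (a^[l] d))))) ≤
      Real.exp (-(m * M / (6 * L))) := by
  set E := exceptional M a b with hE
  have hL0 : (0 : ℝ) < L := by
    exact_mod_cast (card_pos.2 ⟨c, hc⟩).trans_le hL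
  have hcard : ∀ c ∈ cyc a, c ∉ shortCyc a m → #{l ∈ range m | a^[l] c ∈ E} ≤ #E := by
    intro c hc hcm
    refine card_le_card_of_injOn (fun l => a^[l] c) (fun l hl => (mem_filter.1 hl).2) ?_
    exact (iterate_injOn_range hc hcm).mono (coe_subset.2 (filter_subset _ _))
  let T := {l ∈ range m | a^[l] c ∉ E ∧ a^[l] d ∉ E}
  have hT : m ≤ 2 * #T := by
    have hsub : range m ⊆ T ∪ ({l ∈ range m | a^[l] c ∈ E} ∪ {l ∈ range m | a^[l] d ∈ E}) := by
      intro l hl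
      simp only [T, mem_union, mem_filter]
      tauto
    have h1 := card_le_card hsub
    have h2 := card_union_le T ({l ∈ range m | a^[l] c ∈ E} ∪ {l ∈ range m | a^[l] d ∈ E})
    have h3 := card_union_le {l ∈ range m | a^[l] c ∈ E} {l ∈ range m | a^[l] d ∈ E}
    have h4 := hcard c hc hcm
    have h5 := hcard d hd hdm
    rw [card_range] at h1
    omega
  have hinj : ∀ c ∈ cyc a, c ∉ shortCyc a m → (∀ l ∈ T, a^[l] c ∉ E) →
      Set.InjOn (fun k : ℕ × ℕ => a^[k.2] (b (a^[k.1] c))) (T ×ˢ range M : Finset (ℕ × ℕ)) := by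
    intro c hc hcm hTc k hk k' hk' h
    rw [mem_coe, mem_product, mem_range] at hk hk'
    have hk1 : k.1 = k'.1 := by
      by_contra hne
      refine iterate_ne_of_notMem_exceptional (iterate_mem_cyc hc k.1) (iterate_mem_cyc hc k'.1)
        (fun h => hne ?_) (hTc _ hk.1) (hTc _ hk'.1) hk.2 hk'.2 h
      exact iterate_injOn_range hc hcm (mem_coe.2 (mem_filter.1 hk.1).1)
        (mem_coe.2 (mem_filter.1 hk'.1).1) h
    refine Prod.ext hk1 ?_
    dsimp only at h
    rw [← hk1] at h
    have hnot : ∀ t < M, a^[t] (b (a^[k.1] c)) ∉ cyc a := fun t ht =>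
      iterate_notMem_cyc_of_notMem_exceptional (iterate_mem_cyc hc _) (hTc _ hk.1) ht
    rcases lt_trichotomy k.2 k'.2 with hlt | heq | hlt
    · exact absurd (mem_cyc_of_iterate_eq hlt h) (hnot _ hk.2)
    · exact heq
    · exact absurd (mem_cyc_of_iterate_eq hlt h.symm) (hnot _ hk'.2)
  have hTc : ∀ l ∈ T, a^[l] c ∉ E := fun l hl => (mem_filter.1 hl).2.1
  have hTd : ∀ l ∈ T, a^[l] d ∉ E := fun l hl => (mem_filter.1 hl).2.2
  have hnot : ∀ c ∈ cyc a, (∀ l ∈ T, a^[l] c ∉ E) → ∀ k ∈ T ×ˢ range M,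
      a^[k.2] (b (a^[k.1] c)) ∉ cyc a := fun c hc h k hk =>
    iterate_notMem_cyc_of_notMem_exceptional (iterate_mem_cyc hc _) (h _ (mem_product.1 hk).1)
      (mem_range.1 (mem_product.1 hk).2)
  calc _ ≤ pr (fun b' : X → X => ∀ k ∈ T ×ˢ range M,
        proj a (b' (a^[k.2] (b (a^[k.1] c)))) ≠ proj a (b' (a^[k.2] (b (a^[k.1] d))))) := by
        refine pr_mono fun b' h k hk => ?_
        have := h k.1 k.2
        rwa [piecewise_eq_of_notMem _ _ _ (hnot c hc hTc k hk),
          piecewise_eq_of_notMem _ _ _ (hnot d hd hTd k hk)] at this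
    _ ≤ Real.exp (-((L : ℝ)⁻¹ * #(T ×ˢ range M) / 3)) := by
        refine pr_forall_mem_le _ _ _ (hinj c hc hcm hTc) (hinj d hd hdm hTd) (fun k hk => ?_)
          (fun x y => proj a x ≠ proj a y) (by positivity) ?_
        · rw [mem_product, mem_range] at hk
          exact iterate_ne_of_notMem_exceptional (iterate_mem_cyc hc k.1) (iterate_mem_cyc hd k.1)
            (fun h => hcd (iterate_injOn_cyc k.1 hc hd h)) (hTc _ hk.1) (hTd _ hk.1) hk.2 hk.2
        · have h1 := inv_card_cyc_le_pr_proj_eq a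
          have h2 : (L : ℝ)⁻¹ ≤ (#(cyc a) : ℝ)⁻¹ :=
            inv_anti₀ (by exact_mod_cast card_pos.2 ⟨c, hc⟩) (by exact_mod_cast hL)
          have h3 := Real.add_one_le_exp (-(L : ℝ)⁻¹)
          rw [pr_not fun w : X × X => proj a w.1 = proj a w.2]
          linarith
    _ ≤ _ := by
        rw [Real.exp_le_exp, neg_le_neg_iff, card_product, card_range]
        have hT' : (m : ℝ) ≤ 2 * #T := by exact_mod_cast hT
        have hM : (0 : ℝ) ≤ M := by positivity
        push_cast
        rw [inv_mul_eq_div, div_div, div_le_div_iff₀ (by positivity) (by positivity)]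
        nlinarith [mul_le_mul_of_nonneg_right (mul_le_mul_of_nonneg_right hT' hM) hL0.le]

theorem pr_not_merged_le (a : X → X) {M L m : ℕ} (hL : #(cyc a) ≤ L) :
    pr (fun b : X → X => 4 * #(exceptional M a b) ≤ m ∧ ∃ c d, (c ∈ cyc a ∧ d ∈ cyc a ∧
      c ∉ shortCyc a m ∧ d ∉ shortCyc a m ∧ c ≠ d) ∧
      ∀ l j, proj a (b (a^[j] (b (a^[l] c)))) ≠ proj a (b (a^[j] (b (a^[l] d))))) ≤
      (Fintype.card X : ℝ) ^ 2 * Real.exp (-(m * M / (6 * L))) := by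
  rw [pr_piecewise (cyc a)]
  have hglue : ∀ b b' : X → X, ∀ c ∈ cyc a, (cyc a).piecewise b b' c = b c :=
    fun b b' c hc => piecewise_eq_of_mem _ _ _ hc
  refine (pr_mono fun w h => ?_).trans (pr_prod_le_const (fun b b' : X → X => ∃ c d,
    (4 * #(exceptional M a b) ≤ m ∧ c ∈ cyc a ∧ d ∈ cyc a ∧
      c ∉ shortCyc a m ∧ d ∉ shortCyc a m ∧ c ≠ d) ∧
      ∀ l j, proj a ((cyc a).piecewise b b' (a^[j] (b (a^[l] c)))) ≠
        proj a ((cyc a).piecewise b b' (a^[j] (b (a^[l] d))))) _ fun b => ?_)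
  · obtain ⟨h1, c, d, ⟨hc, hd, h2⟩, h3⟩ := h
    rw [exceptional_congr (hglue w.1 w.2)] at h1
    refine ⟨c, d, ⟨h1, hc, hd, h2⟩, fun l j => ?_⟩
    have := h3 l j
    rwa [hglue _ _ _ (iterate_mem_cyc hc l), hglue _ _ _ (iterate_mem_cyc hd l)] at this
  · refine pr_exists_pair_le _ fun c d => ?_
    by_cases h : 4 * #(exceptional M a b) ≤ m ∧ c ∈ cyc a ∧ d ∈ cyc a ∧
      c ∉ shortCyc a m ∧ d ∉ shortCyc a m ∧ c ≠ d
    · obtain ⟨hb, hc, hd, hcm, hdm, hcd⟩ := h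
      refine (pr_mono fun b' h => h.2).trans ?_
      exact pr_not_merged_of_exceptional_le a b hL hb hc hd hcm hdm hcd
    · simp only [h, false_and]
      rw [pr_eq_zero fun _ => id]
      positivity

end UnionBound

section Conclusion

open Function

variable {X : Type*} [Fintype X] [DecidableEq X]

/-- The conditions on a pair of self-maps under which all pairs of points can be merged. -/
def Merging (m₀ m : ℕ) (a b : X → X) : Prop :=
  (∀ c ∈ shortCyc a m₀, proj a (b c) ∉ shortCyc a m₀) ∧
  (∀ c ∈ cyc a, ∀ d ∈ cyc a, c ∉ shortCyc a m₀ → d ∉ shortCyc a m₀ → c ≠ d →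
    ∃ l, proj a (b (a^[l] c)) ∉ shortCyc a m ∧ proj a (b (a^[l] d)) ∉ shortCyc a m) ∧
  (∀ c ∈ cyc a, ∀ d ∈ cyc a, c ∉ shortCyc a m → d ∉ shortCyc a m → c ≠ d →
    ∃ l j, proj a (b (a^[j] (b (a^[l] c)))) = proj a (b (a^[j] (b (a^[l] d)))))

theorem pr_not_merging_le [Nonempty X] (m₀ m M L : ℕ) (hm : 0 < m) {t : ℝ} (ht : 0 < t) :
    pr (fun w : (X → X) × (X → X) => ¬ Merging m₀ m w.1 w.2) ≤
      Fintype.card X * tail X L + (L * m / Fintype.card X + tail X L) / (1 / 4) + m₀ / t +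
      t * (L * m₀ / Fintype.card X + tail X L) +
      (Fintype.card X : ℝ) ^ 2 * Real.exp (-(m₀ / 6)) +
      L * (M * L / Fintype.card X + tail X L + L * (M * M / Fintype.card X)) / (m / 4) +
      (Fintype.card X : ℝ) ^ 2 * Real.exp (-(m * M / (6 * L))) := by
  have hm' : (0 : ℝ) < m := by exact_mod_cast hm
  let F₁ : (X → X) × (X → X) → Prop := fun w => L < #(cyc w.1)
  let F₂ : (X → X) × (X → X) → Prop := fun w => 1 / 4 < pr fun x => proj w.1 x ∈ shortCyc w.1 m
  let F₃ : (X → X) × (X → X) → Prop := fun w => t < #(shortCyc w.1 m₀)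
  let F₄ : (X → X) × (X → X) → Prop := fun w => (#(shortCyc w.1 m₀) : ℝ) ≤ t ∧
      ∃ c ∈ shortCyc w.1 m₀, proj w.1 (w.2 c) ∈ shortCyc w.1 m₀
  let F₅ : (X → X) × (X → X) → Prop := fun w =>
    pr (fun x => proj w.1 x ∈ shortCyc w.1 m) ≤ 1 / 4 ∧ ∃ c d, (c ∈ cyc w.1 ∧ d ∈ cyc w.1 ∧
      c ∉ shortCyc w.1 m₀ ∧ d ∉ shortCyc w.1 m₀ ∧ c ≠ d) ∧
      ∀ l, proj w.1 (w.2 (w.1^[l] c)) ∈ shortCyc w.1 m ∨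
        proj w.1 (w.2 (w.1^[l] d)) ∈ shortCyc w.1 m
  let F₆ : (X → X) × (X → X) → Prop := fun w =>
    #(cyc w.1) ≤ L ∧ (m / 4 : ℝ) < #(exceptional M w.1 w.2)
  let F₇ : (X → X) × (X → X) → Prop := fun w => #(cyc w.1) ≤ L ∧
    4 * #(exceptional M w.1 w.2) ≤ m ∧ ∃ c d, (c ∈ cyc w.1 ∧ d ∈ cyc w.1 ∧
      c ∉ shortCyc w.1 m ∧ d ∉ shortCyc w.1 m ∧ c ≠ d) ∧
      ∀ l j, proj w.1 (w.2 (w.1^[j] (w.2 (w.1^[l] c)))) ≠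
        proj w.1 (w.2 (w.1^[j] (w.2 (w.1^[l] d))))
  have h₁ : pr F₁ ≤ Fintype.card X * tail X L :=
    (pr_fst fun a : X → X => L < #(cyc a)).trans_le (pr_lt_card_cyc_le L)
  have h₂ : pr F₂ ≤ (L * m / Fintype.card X + tail X L) / (1 / 4) :=
    (pr_fst fun a : X → X => 1 / 4 < pr fun x => proj a x ∈ shortCyc a m).trans_le
      (pr_lt_pr_proj_le m L (by norm_num))
  have h₃ : pr F₃ ≤ m₀ / t :=
    (pr_fst fun a : X → X => t < #(shortCyc a m₀)).trans_le (pr_lt_card_shortCyc_le m₀ ht)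
  have h₄ : pr F₄ ≤ t * (L * m₀ / Fintype.card X + tail X L) :=
    pr_short_sent_to_short_le m₀ L ht.le
  have h₅ : pr F₅ ≤ (Fintype.card X : ℝ) ^ 2 * Real.exp (-(m₀ / 6)) := by
    refine pr_prod_le_const (fun a b => F₅ (a, b)) _ fun a => ?_
    by_cases ha : pr (fun x => proj a x ∈ shortCyc a m) ≤ 1 / 4
    · exact (pr_mono fun b h => h.2).trans (pr_not_sent_to_long_le a m₀ m ha)
    · rw [pr_eq_zero fun b h => ha h.1]
      positivity
  have h₆ : pr F₆ ≤ L * (M * L / Fintype.card X + tail X L + L * (M * M / Fintype.card X)) /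
      (m / 4) := pr_lt_card_exceptional_le M L (by positivity)
  have h₇ : pr F₇ ≤ (Fintype.card X : ℝ) ^ 2 * Real.exp (-(m * M / (6 * L))) := by
    refine pr_prod_le_const (fun a b => F₇ (a, b)) _ fun a => ?_
    by_cases ha : #(cyc a) ≤ L
    · exact (pr_mono fun b h => h.2).trans (pr_not_merged_le a ha)
    · rw [pr_eq_zero fun b h => ha h.1]
      positivity
  refine (pr_mono (q := fun w => (((((F₁ w ∨ F₂ w) ∨ F₃ w) ∨ F₄ w) ∨ F₅ w) ∨ F₆ w) ∨ F₇ w)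
    fun w hw => ?_).trans ?_
  · by_contra hF
    simp only [not_or] at hF
    obtain ⟨⟨⟨⟨⟨⟨f₁, f₂⟩, f₃⟩, f₄⟩, f₅⟩, f₆⟩, f₇⟩ := hF
    have g₁ : #(cyc w.1) ≤ L := not_lt.1 f₁
    have g₆ : 4 * #(exceptional M w.1 w.2) ≤ m := by
      have := not_lt.1 fun h => f₆ ⟨g₁, h⟩
      have : (4 * #(exceptional M w.1 w.2) : ℝ) ≤ m := by linarith
      exact_mod_cast this
    refine hw ⟨fun c hc h => f₄ ⟨not_lt.1 f₃, c, hc, h⟩, fun c hc d hd hcm hdm hcd => ?_,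
      fun c hc d hd hcm hdm hcd => ?_⟩
    · by_contra h
      refine f₅ ⟨not_lt.1 f₂, c, d, ⟨hc, hd, hcm, hdm, hcd⟩, fun l => ?_⟩
      by_contra h'
      exact h ⟨l, not_or.1 h'⟩
    · by_contra h
      exact f₇ ⟨g₁, g₆, c, d, ⟨hc, hd, hcm, hdm, hcd⟩, fun l j h' => h ⟨l, j, h'⟩⟩
  · refine (pr_or_le _ _).trans (add_le_add ?_ h₇)
    refine (pr_or_le _ _).trans (add_le_add ?_ h₆)
    refine (pr_or_le _ _).trans (add_le_add ?_ h₅)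
    refine (pr_or_le _ _).trans (add_le_add ?_ h₄)
    refine (pr_or_le _ _).trans (add_le_add ?_ h₃)
    exact (pr_or_le _ _).trans (add_le_add h₁ h₂)

theorem pr_not_isSynchronizing_le {n : ℕ} (hn : 0 < n) {A : Type} [Fintype A] [DecidableEq A]
    (hA : 2 ≤ Fintype.card A) {m₀ m : ℕ} (hm₀ : 0 < m₀) (hm : m₀ ≤ m) :
    pr (fun δ : Fin n → A → Fin n => ¬ IsSynchronizing δ) ≤
      pr (fun w : (Fin n → Fin n) × (Fin n → Fin n) => ¬ Merging m₀ m w.1 w.2) := by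
  have : Nonempty (Fin n) := ⟨⟨0, hn⟩⟩
  obtain ⟨α, β, hαβ⟩ := Fintype.exists_pair_of_one_lt_card hA
  rw [← pr_eval_pair hαβ fun a b : Fin n → Fin n => ¬ Merging m₀ m a b,
    ← pr_equiv (Equiv.piComm fun (_ : Fin n) (_ : A) => Fin n)]
  refine pr_mono fun δ hδ hmer => hδ (isSynchronizing_of_forall_pair hn δ ?_)
  obtain ⟨h₁, h₂, h₃⟩ := hmer
  exact related_of_merging hm₀ hm h₁ h₂ h₃ (fun x y => ∃ w, act δ w x = act δ w y)
    (fun x => ⟨[], rfl⟩) (fun x y ⟨w, h⟩ => ⟨w, h.symm⟩) (fun x y ⟨w, h⟩ => ⟨α :: w, h⟩)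
    (fun x y ⟨w, h⟩ => ⟨β :: w, h⟩)

/-- The elementary estimate combining all error terms, with `z = n ^ (1 / 8)` and `u` a small power
of `n`. -/
theorem error_terms_le {z u L m M m₀ τ η : ℝ} (hz : 1 ≤ z) (hu : 1 ≤ u)
    (hL : z ^ 4 * u ≤ L) (hL' : L ≤ 2 * (z ^ 4 * u)) (hm : z ^ 3 ≤ m) (hm' : m ≤ 2 * z ^ 3)
    (hM : z * u ^ 4 ≤ M) (hM' : M ≤ 2 * (z * u ^ 4)) (hm₀ : u ≤ m₀) (hm₀' : m₀ ≤ 2 * u)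
    (hτ : τ = Real.exp (-(L ^ 2 / (2 * z ^ 8)))) (hη : η = Real.exp (-(u / 12)))
    (hηz : z ^ 17 * η ≤ 1) :
    z ^ 8 * τ + (L * m / z ^ 8 + τ) / (1 / 4) + m₀ / z ^ 2 + z ^ 2 * (L * m₀ / z ^ 8 + τ) +
      (z ^ 8) ^ 2 * Real.exp (-(m₀ / 6)) +
      L * (M * L / z ^ 8 + τ + L * (M * M / z ^ 8)) / (m / 4) +
      (z ^ 8) ^ 2 * Real.exp (-(m * M / (6 * L))) ≤ 200 * (u ^ 10 / z) := by
  have hz0 : 0 < z := by linarith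
  have hu0 : 0 < u := by linarith
  have hL0 : 0 < L := lt_of_lt_of_le (by positivity) hL
  have hm0 : 0 < m := lt_of_lt_of_le (by positivity) hm
  have hM0 : 0 < M := lt_of_lt_of_le (by positivity) hM
  have hm₀0 : 0 < m₀ := by linarith
  have hη0 : 0 ≤ η := hη ▸ (Real.exp_pos _).le
  have hτ0 : 0 ≤ τ := hτ ▸ (Real.exp_pos _).le
  have hu2 : u ≤ u ^ 2 := le_self_pow₀ hu (by norm_num)
  have hu3 : u ≤ u ^ 3 := le_self_pow₀ hu (by norm_num)
  have hτη : τ ≤ η := by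
    rw [hτ, hη, Real.exp_le_exp, neg_le_neg_iff, div_le_div_iff₀ (by norm_num) (by positivity)]
    have h1 : (z ^ 4 * u) ^ 2 ≤ L ^ 2 := pow_le_pow_left₀ (by positivity) hL 2
    have h2 : z ^ 8 * u ≤ z ^ 8 * u ^ 2 := mul_le_mul_of_nonneg_left hu2 (by positivity)
    have h3 : 0 < z ^ 8 * u := by positivity
    nlinarith
  have he₅ : Real.exp (-(m₀ / 6)) ≤ η := by
    rw [hη, Real.exp_le_exp]
    linarith
  have he₇ : Real.exp (-(m * M / (6 * L))) ≤ η := by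
    rw [hη, Real.exp_le_exp, neg_le_neg_iff, div_le_div_iff₀ (by norm_num) (by positivity)]
    have h1 : z ^ 3 * (z * u ^ 4) ≤ m * M := mul_le_mul hm hM (by positivity) hm0.le
    have h2 : u * (6 * L) ≤ u * (6 * (2 * (z ^ 4 * u))) := by gcongr
    have h3 : z ^ 4 * u * u ≤ z ^ 4 * u * u ^ 3 := mul_le_mul_of_nonneg_left hu3 (by positivity)
    nlinarith
  have hzp : ∀ k ≤ 16, z ^ k * η ≤ 1 / z := by
    intro k hk
    rw [le_div_iff₀ hz0]
    calc z ^ k * η * z = z ^ (k + 1) * η := by ring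
      _ ≤ z ^ 17 * η := by
          gcongr
          omega
      _ ≤ 1 := hηz
  have hup : ∀ k ≤ 10, u ^ k ≤ u ^ 10 := fun k hk => pow_le_pow_right₀ hu hk
  have hdiv : ∀ k ≤ 10, ∀ j, 1 ≤ j → u ^ k / z ^ j ≤ u ^ 10 / z := by
    intro k hk j hj
    refine div_le_div₀ (by positivity) (hup k hk) hz0 (le_self_pow₀ hz (by omega))
  have hinv : 1 / z ≤ u ^ 10 / z := by
    gcongr
    exact one_le_pow₀ hu
  have t₁ : z ^ 8 * τ ≤ u ^ 10 / z :=
    ((mul_le_mul_of_nonneg_left hτη (by positivity)).trans (hzp 8 (by norm_num))).trans hinv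
  have hτ' : τ ≤ u ^ 10 / z := by
    refine (hτη.trans ?_).trans ((hzp 0 (by norm_num)).trans hinv)
    simp
  have t₂ : (L * m / z ^ 8 + τ) / (1 / 4) ≤ 20 * (u ^ 10 / z) := by
    have h : L * m / z ^ 8 ≤ 4 * (u ^ 1 / z ^ 1) := by
      calc L * m / z ^ 8 ≤ (2 * (z ^ 4 * u)) * (2 * z ^ 3) / z ^ 8 := by gcongr
        _ = _ := by field_simp; ring
    have := hdiv 1 (by norm_num) 1 le_rfl
    linarith
  have t₃ : m₀ / z ^ 2 ≤ 2 * (u ^ 10 / z) := by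
    calc m₀ / z ^ 2 ≤ 2 * u / z ^ 2 := by gcongr
      _ = 2 * (u ^ 1 / z ^ 2) := by ring
      _ ≤ _ := by
        have := hdiv 1 (by norm_num) 2 (by norm_num)
        linarith
  have t₄ : z ^ 2 * (L * m₀ / z ^ 8 + τ) ≤ 5 * (u ^ 10 / z) := by
    have h : z ^ 2 * (L * m₀ / z ^ 8) ≤ 4 * (u ^ 2 / z ^ 2) := by
      calc z ^ 2 * (L * m₀ / z ^ 8) ≤ z ^ 2 * ((2 * (z ^ 4 * u)) * (2 * u) / z ^ 8) := by gcongr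
        _ = _ := by field_simp; ring
    have h1 := hdiv 2 (by norm_num) 2 (by norm_num)
    have h2 := ((mul_le_mul_of_nonneg_left hτη (by positivity)).trans
      (hzp 2 (by norm_num))).trans hinv
    rw [mul_add]
    linarith
  have t₅ : (z ^ 8) ^ 2 * Real.exp (-(m₀ / 6)) ≤ u ^ 10 / z := by
    rw [← pow_mul]
    exact ((mul_le_mul_of_nonneg_left he₅ (by positivity)).trans (hzp 16 le_rfl)).trans hinv
  have t₇ : (z ^ 8) ^ 2 * Real.exp (-(m * M / (6 * L))) ≤ u ^ 10 / z := by
    rw [← pow_mul]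
    exact ((mul_le_mul_of_nonneg_left he₇ (by positivity)).trans (hzp 16 le_rfl)).trans hinv
  have t₆ : L * (M * L / z ^ 8 + τ + L * (M * M / z ^ 8)) / (m / 4) ≤ 104 * (u ^ 10 / z) := by
    calc _ ≤ 2 * (z ^ 4 * u) * (2 * (z * u ^ 4) * (2 * (z ^ 4 * u)) / z ^ 8 + η +
          2 * (z ^ 4 * u) * (2 * (z * u ^ 4) * (2 * (z * u ^ 4)) / z ^ 8)) / (z ^ 3 / 4) := by
          gcongr
      _ = 32 * (u ^ 6 / z ^ 2) + 8 * (u * (z ^ 1 * η)) + 64 * (u ^ 10 / z ^ 1) := by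
          field_simp
          ring
      _ ≤ _ := by
          have h1 := hdiv 6 (by norm_num) 2 (by norm_num)
          have h2 := hdiv 10 le_rfl 1 le_rfl
          have h3 : u * (z ^ 1 * η) ≤ u ^ 10 / z := by
            calc u * (z ^ 1 * η) ≤ u * (1 / z) := by
                  gcongr
                  exact hzp 1 (by norm_num)
              _ = u ^ 1 / z ^ 1 := by ring
              _ ≤ _ := hdiv 1 (by norm_num) 1 le_rfl
          linarith
  have : 0 ≤ u ^ 10 / z := by positivity
  linarith

theorem eventually_rpow_mul_exp_le {s : ℝ} (hs : 0 < s) :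
    ∀ᶠ n : ℕ in Filter.atTop, (n : ℝ) ^ (17 / 8 : ℝ) * Real.exp (-((n : ℝ) ^ s / 12)) ≤ 1 := by
  have h := (isLittleO_rpow_exp_pos_mul_atTop (17 / 8 / s) (b := 1 / 12) (by norm_num)).def
    one_pos
  have ht : Filter.Tendsto (fun n : ℕ => (n : ℝ) ^ s) Filter.atTop Filter.atTop :=
    (tendsto_rpow_atTop hs).comp tendsto_natCast_atTop_atTop
  filter_upwards [ht.eventually h] with n hn
  rw [← Real.rpow_mul (by positivity), mul_div_cancel₀ _ hs.ne', one_mul, Real.norm_eq_abs,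
    Real.norm_eq_abs, abs_of_nonneg (by positivity), abs_of_nonneg (by positivity)] at hn
  rw [Real.exp_neg, ← div_eq_mul_inv, div_le_one (Real.exp_pos _)]
  rwa [one_div_mul_eq_div] at hn

theorem natCeil_le_two_mul {x : ℝ} (hx : 1 ≤ x) : (⌈x⌉₊ : ℝ) ≤ 2 * x := by
  have := Nat.ceil_lt_add_one (show 0 ≤ x by linarith)
  linarith

theorem pr_not_isSynchronizing_le_rpow {ε : ℝ} (hε₀ : 0 < ε) (hε₁ : ε < 1 / 8) {A : Type}
    [Fintype A] [DecidableEq A] (hA : 2 ≤ Fintype.card A) :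
    ∀ᶠ n : ℕ in Filter.atTop, pr (fun δ : Fin n → A → Fin n => ¬ IsSynchronizing δ) ≤
      200 * (n : ℝ) ^ (-(1 / 8 : ℝ) + ε) := by
  filter_upwards [eventually_rpow_mul_exp_le (s := ε / 10) (by positivity),
    Filter.eventually_gt_atTop 0] with n hexp hn
  have hn0 : (0 : ℝ) < n := by exact_mod_cast hn
  have hn1 : (1 : ℝ) ≤ n := by exact_mod_cast hn
  have : Nonempty (Fin n) := ⟨⟨0, hn⟩⟩
  obtain ⟨z, hz⟩ : ∃ z, z = (n : ℝ) ^ (1 / 8 : ℝ) := ⟨_, rfl⟩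
  obtain ⟨u, hu⟩ : ∃ u, u = (n : ℝ) ^ (ε / 10 : ℝ) := ⟨_, rfl⟩
  have hz1 : 1 ≤ z := hz ▸ Real.one_le_rpow hn1 (by norm_num)
  have hu1 : 1 ≤ u := hu ▸ Real.one_le_rpow hn1 (by positivity)
  have hz0 : 0 < z := by linarith
  have hu0 : 0 < u := by linarith
  have hzn : z ^ 8 = n := by
    rw [hz, ← Real.rpow_mul_natCast hn0.le]
    norm_num
  have huz : u ≤ z ^ 3 := by
    have h : u ≤ z := hz ▸ hu ▸ Real.rpow_le_rpow_of_exponent_le hn1 (by linarith)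
    exact h.trans (le_self_pow₀ hz1 (by norm_num))
  have hη : z ^ 17 * Real.exp (-(u / 12)) ≤ 1 := by
    rw [hz, hu, ← Real.rpow_mul_natCast hn0.le]
    convert hexp using 3
    norm_num
  have hrhs : u ^ 10 / z = (n : ℝ) ^ (-(1 / 8 : ℝ) + ε) := by
    rw [hz, hu, ← Real.rpow_mul_natCast hn0.le, ← Real.rpow_sub hn0]
    congr 1
    push_cast
    ring
  have hm₀ : 0 < ⌈u⌉₊ := Nat.ceil_pos.2 hu0
  have hm : ⌈u⌉₊ ≤ ⌈z ^ 3⌉₊ := Nat.ceil_le_ceil huz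
  refine (pr_not_isSynchronizing_le hn hA hm₀ hm).trans ((pr_not_merging_le _ _ ⌈z * u ^ 4⌉₊
    ⌈z ^ 4 * u⌉₊ (hm₀.trans_le hm) (t := z ^ 2) (by positivity)).trans ?_)
  rw [← hrhs, Fintype.card_fin, ← hzn]
  refine error_terms_le hz1 hu1 (Nat.le_ceil _) (natCeil_le_two_mul ?_) (Nat.le_ceil _)
    (natCeil_le_two_mul ?_) (Nat.le_ceil _) (natCeil_le_two_mul ?_) (Nat.le_ceil _)
    (natCeil_le_two_mul hu1) ?_ rfl hη
  · exact one_le_mul_of_one_le_of_one_le (one_le_pow₀ hz1) hu1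
  · exact one_le_pow₀ hz1
  · exact one_le_mul_of_one_le_of_one_le hz1 (one_le_pow₀ hu1)
  · rw [tail, Fintype.card_fin, hzn]

end Conclusion

end RandomAutomaton

/-- For `0 < ε < 1/8` and an alphabet `A` with at least two letters, under the uniform
distribution on complete `n`-state deterministic automata over `A`, the probability that
the automaton is not synchronizing is `O(n^(-1/8+ε))`; in particular, a uniform random
complete automaton is synchronizing with high probability. -/
theorem random_automaton_synchronizing_whp (ε : ℝ) (hε0 : 0 < ε) (hε1 : ε < 1/8)
    (A : Type) [Fintype A] [DecidableEq A] (hA : 2 ≤ Fintype.card A) :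
    ∃ C : ℝ, 0 < C ∧ ∃ N : ℕ, ∀ n ≥ N,
      (((Finset.univ : Finset (Fin n → A → Fin n)).filter
          (fun δ => ¬ IsSynchronizing δ)).card : ℝ)
        / (Fintype.card (Fin n → A → Fin n) : ℝ)
        ≤ C * (n : ℝ) ^ (-(1/8 : ℝ) + ε) := by
  have h := RandomAutomaton.pr_not_isSynchronizing_le_rpow hε0 hε1 hA
  obtain ⟨N, hN⟩ := Filter.eventually_atTop.1 h
  refine ⟨200, by norm_num, N, fun n hn => ?_⟩
  have h := hN n hn
  rw [RandomAutomaton.pr_eq_card_div] at h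
  convert h
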